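/- arXiv:1804.06188 — 2 statements merged into one kernel-verified Lean document; each statement's English description precedes it below -/
import Mathlib

section
/- Let α be a finite type with N elements, let k and n be integers with 1 ≤ k ≤ n ≤ N, and set m = ⌊n/k⌋. Let H be a nonempty class of {0,1}-valued hypotheses f : Finset α → ℝ whose VC dimension (with respect to size-k subsets of α) equals d, where 1 ≤ d ≤ m. If C is a uniformly random size-n subset of α, then E[ sup_{f ∈ H} | Q_k(Finset.univ, f) − Q_k(C, f) | ] ≤ 2 · √( 2 · d · log(2 · e · m / d) / m ). -/
/-- The average of `f` over all size-`k` subsets of `C`: the probability `Q_{Υ,k}(f)` that a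
uniformly random size-`k` fragment of the relational example with domain `C` satisfies `f`. -/
noncomputable def Qk {α : Type*} [DecidableEq α] (k : ℕ) (C : Finset α) (f : Finset α → ℝ) : ℝ :=
  ((C.card.choose k : ℝ))⁻¹ * ∑ S ∈ C.powersetCard k, f S

/-- `H` shatters the collection `X` of size-`k` subsets of `α`: every `S ∈ X` has cardinality `k`,
and for every `Y ⊆ X` there is `f ∈ H` taking value `1` on `Y` and `0` on `X \ Y`. -/
def Shatters {α : Type*} [DecidableEq α] (k : ℕ)
    (H : Set (Finset α → ℝ)) (X : Finset (Finset α)) : Prop :=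
  (∀ S ∈ X, S.card = k) ∧
    ∀ Y ⊆ X, ∃ f ∈ H, (∀ S ∈ Y, f S = 1) ∧ ∀ S ∈ X \ Y, f S = 0

/-- The VC dimension of `H` with respect to size-`k` subsets of `α` equals `d`: `d` is the largest
cardinality of a collection of size-`k` subsets shattered by `H`. -/
def VCDimEq {α : Type*} [DecidableEq α] (k : ℕ) (H : Set (Finset α → ℝ)) (d : ℕ) : Prop :=
  IsGreatest {m : ℕ | ∃ X : Finset (Finset α), Shatters k H X ∧ X.card = m} d

open Finset BigOperators in
/-- Growth bound for partial binomial sums: `∑_{i ≤ d} C(n, i) ≤ (e n / d)^d`. -/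
lemma sum_choose_le_exp_mul_div_pow {n d : ℕ} (hd : 1 ≤ d) (hdn : d ≤ n) :
    (∑ i ∈ range (d + 1), (n.choose i : ℝ)) ≤ (Real.exp 1 * n / d) ^ d := by
  have hd0 : (0 : ℝ) < d := by exact_mod_cast hd
  have hn0 : (0 : ℝ) < n := by exact_mod_cast lt_of_lt_of_le hd hdn
  have hdn' : (d : ℝ) ≤ n := by exact_mod_cast hdn
  have hr : (1 : ℝ) ≤ n / d := by rwa [one_le_div hd0]
  calc (∑ i ∈ range (d + 1), (n.choose i : ℝ))
      ≤ ∑ i ∈ range (d + 1), (n / d : ℝ) ^ d * ((d / n : ℝ) ^ i * n.choose i) := by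
        refine sum_le_sum fun i hi => ?_
        have hi' : i ≤ d := Nat.lt_succ_iff.mp (mem_range.mp hi)
        have h1 : (1 : ℝ) ≤ (n / d : ℝ) ^ d * (d / n : ℝ) ^ i := by
          have : (n / d : ℝ) ^ d * (d / n : ℝ) ^ i = (n / d : ℝ) ^ (d - i) := by
            rw [← inv_div (n : ℝ) d, inv_pow, pow_sub₀ _ (by positivity) hi']
          rw [this]
          exact one_le_pow₀ hr
        rw [← mul_assoc]
        exact le_mul_of_one_le_left (by positivity) h1
    _ ≤ ∑ i ∈ range (n + 1), (n / d : ℝ) ^ d * ((d / n : ℝ) ^ i * n.choose i) :=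
        sum_le_sum_of_subset_of_nonneg (range_mono (by omega)) fun _ _ _ => by positivity
    _ = (n / d : ℝ) ^ d * (d / n + 1) ^ n := by
        rw [← mul_sum, add_pow]
        simp
    _ ≤ (n / d : ℝ) ^ d * Real.exp (d / n) ^ n := by
        gcongr
        exact Real.add_one_le_exp _
    _ = (Real.exp 1 * n / d) ^ d := by
        rw [← Real.exp_nat_mul, mul_div_cancel₀ _ hn0.ne', mul_div_assoc, mul_pow,
          ← Real.exp_nat_mul, mul_one, mul_comm]

open BigOperators in
/-- Jensen's inequality for the exponential, in the form of an upper bound on a mean. -/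
lemma expect_le_of_expect_exp_le {Ω : Type*} [Fintype Ω] [Nonempty Ω] (Y : Ω → ℝ) (B : ℝ)
    (h : 𝔼 ω, Real.exp (Y ω) ≤ Real.exp B) : 𝔼 ω, Y ω ≤ B := by
  have h1 : 𝔼 ω, (Y ω - B + 1) ≤ 𝔼 ω, Real.exp (Y ω) * Real.exp (-B) :=
    Finset.expect_le_expect fun ω _ => by
      rw [← Real.exp_add, ← sub_eq_add_neg]
      exact Real.add_one_le_exp _
  rw [Finset.expect_add_distrib, Finset.expect_sub_distrib, ← Finset.expect_mul,
    Fintype.expect_const, Fintype.expect_const] at h1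
  have h2 := mul_le_mul_of_nonneg_right h (Real.exp_pos (-B)).le
  rw [← Real.exp_add, add_neg_cancel, Real.exp_zero] at h2
  linarith

open BigOperators in
/-- Moment generating function of a Rademacher sum. -/
lemma expect_exp_sum_sign {m : ℕ} (a : Fin m → ℝ) :
    𝔼 ε : Fin m → Bool, Real.exp (∑ i, (if ε i then 1 else -1) * a i) =
      ∏ i, Real.cosh (a i) := by
  have h : ∑ ε : Fin m → Bool, Real.exp (∑ i, (if ε i then 1 else -1) * a i) =
      ∏ i, ∑ b : Bool, Real.exp ((if b then 1 else -1) * a i) := by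
    rw [Fintype.prod_sum]
    simp_rw [Real.exp_sum]
  rw [Fintype.expect_eq_sum_div_card, h]
  simp_rw [Real.cosh_eq, Finset.prod_div_distrib]
  simp

/-- The exponential of a finite supremum of absolute values is at most a sum of two-sided
exponentials over any finite set of parameters covering the supremum. -/
lemma exp_mul_iSup_abs_le_sum {ι V : Type*} [Finite ι] [Nonempty ι] (s : Finset V) (a : ι → V)
    (hs : ∀ h, a h ∈ s) (φ : V → ℝ) (t : ℝ) :
    Real.exp (t * ⨆ h, |φ (a h)|) ≤
      ∑ v ∈ s, (Real.exp (t * φ v) + Real.exp (-t * φ v)) := by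
  obtain ⟨h, hh⟩ := exists_eq_ciSup_of_finite (f := fun h => |φ (a h)|)
  rw [← hh]
  refine le_trans ?_ (Finset.single_le_sum
    (f := fun v => Real.exp (t * φ v) + Real.exp (-t * φ v)) (fun v _ => by positivity) (hs h))
  rcases abs_cases (φ (a h)) with ⟨he, _⟩ | ⟨he, _⟩
  · rw [he]
    exact le_add_of_nonneg_right (Real.exp_pos _).le
  · rw [he, mul_neg, ← neg_mul]
    exact le_add_of_nonneg_left (Real.exp_pos _).le

open BigOperators in
/-- Massart's finite class lemma for Rademacher averages, with absolute values. -/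
lemma expect_iSup_abs_sum_sign_le {ι : Type*} [Finite ι] [Nonempty ι] {m : ℕ} (hm : 0 < m)
    (a : ι → Fin m → ℝ) (ha : ∀ h i, |a h i| ≤ 1) (M : ℝ)
    (hM : ((Set.range a).ncard : ℝ) ≤ M) :
    𝔼 ε : Fin m → Bool, (⨆ h, |∑ i, (if ε i then 1 else -1) * a h i|) ≤
      Real.sqrt (2 * m * Real.log (2 * M)) := by
  classical
  have hm0 : (0 : ℝ) < m := by exact_mod_cast hm
  have hfin : (Set.range a).Finite := Set.finite_range a
  have hM1 : 1 ≤ M := by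
    refine le_trans ?_ hM
    exact_mod_cast (Set.ncard_pos hfin).2 (Set.range_nonempty a)
  set K := Real.log (2 * M) with hK
  have hKpos : 0 < K := Real.log_pos (by linarith)
  set t := Real.sqrt (2 * K / m) with ht
  have htpos : 0 < t := Real.sqrt_pos.2 (by positivity)
  have ht2 : t ^ 2 = 2 * K / m := Real.sq_sqrt (by positivity)
  have hmgf : ∀ (c : ℝ) (v : Fin m → ℝ), (∀ i, |v i| ≤ 1) →
      𝔼 ε : Fin m → Bool, Real.exp (c * ∑ i, (if ε i then 1 else -1) * v i) ≤
        Real.exp (m * c ^ 2 / 2) := by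
    intro c v hv
    have h1 := expect_exp_sum_sign fun i => c * v i
    simp_rw [Finset.mul_sum, mul_left_comm c]
    rw [h1]
    calc ∏ i, Real.cosh (c * v i) ≤ ∏ _i : Fin m, Real.exp (c ^ 2 / 2) := by
          refine Finset.prod_le_prod (fun i _ => (Real.cosh_pos _).le) fun i _ => ?_
          refine (Real.cosh_le_exp_half_sq _).trans (Real.exp_le_exp.2 ?_)
          have : v i ^ 2 ≤ 1 := (sq_le_one_iff_abs_le_one _).2 (hv i)
          rw [mul_pow]
          nlinarith [sq_nonneg c]
      _ = Real.exp (m * c ^ 2 / 2) := by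
          rw [Finset.prod_const, Finset.card_univ, Fintype.card_fin, ← Real.exp_nat_mul,
            mul_div_assoc]
  have hexp : 𝔼 ε : Fin m → Bool,
      Real.exp (t * ⨆ h, |∑ i, (if ε i then 1 else -1) * a h i|) ≤
        Real.exp (K + m * t ^ 2 / 2) := by
    calc 𝔼 ε : Fin m → Bool, Real.exp (t * ⨆ h, |∑ i, (if ε i then 1 else -1) * a h i|)
        ≤ 𝔼 ε : Fin m → Bool, ∑ v ∈ hfin.toFinset,
            (Real.exp (t * ∑ i, (if ε i then 1 else -1) * v i) +
              Real.exp ((-t) * ∑ i, (if ε i then 1 else -1) * v i)) := by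
          refine Finset.expect_le_expect fun ε _ => ?_
          exact exp_mul_iSup_abs_le_sum hfin.toFinset a (fun h => by simp)
            (fun v => ∑ i, (if ε i then 1 else -1) * v i) t
      _ = ∑ v ∈ hfin.toFinset,
            (𝔼 ε : Fin m → Bool, Real.exp (t * ∑ i, (if ε i then 1 else -1) * v i) +
              𝔼 ε : Fin m → Bool, Real.exp ((-t) * ∑ i, (if ε i then 1 else -1) * v i)) := by
          rw [Finset.expect_sum_comm]
          simp_rw [Finset.expect_add_distrib]
      _ ≤ ∑ _v ∈ hfin.toFinset, 2 * Real.exp (m * t ^ 2 / 2) := by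
          refine Finset.sum_le_sum fun v hv => ?_
          obtain ⟨h, rfl⟩ := hfin.mem_toFinset.1 hv
          have h1 := hmgf t (a h) (ha h)
          have h2 := hmgf (-t) (a h) (ha h)
          rw [neg_sq] at h2
          linarith
      _ = (Set.range a).ncard * (2 * Real.exp (m * t ^ 2 / 2)) := by
          rw [Finset.sum_const, nsmul_eq_mul, Set.ncard_eq_toFinset_card _ hfin]
      _ ≤ M * (2 * Real.exp (m * t ^ 2 / 2)) := by gcongr
      _ = Real.exp (K + m * t ^ 2 / 2) := by
          rw [Real.exp_add, hK, Real.exp_log (by linarith)]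
          ring
  have hmain := expect_le_of_expect_exp_le _ _ hexp
  rw [← Finset.mul_expect] at hmain
  have hprod : t * Real.sqrt (2 * m * K) = K + m * t ^ 2 / 2 := by
    rw [ht, ← Real.sqrt_mul (by positivity), ← ht, ht2,
      show 2 * K / m * (2 * m * K) = (2 * K) ^ 2 by field_simp,
      Real.sqrt_sq (by positivity)]
    field_simp
    ring
  rw [← hprod] at hmain
  exact le_of_mul_le_mul_left hmain htpos

open BigOperators in
/-- A coordinate of a uniformly random tuple is uniformly distributed. -/
lemma expect_pi_apply {ι P : Type*} [Fintype ι] [DecidableEq ι] [Fintype P] [Nonempty P]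
    (i : ι) (φ : P → ℝ) : 𝔼 s : ι → P, φ (s i) = 𝔼 x, φ x := by
  rw [Fintype.expect_equiv (Equiv.funSplitAt i P) (fun s => φ (s i)) (fun q => φ q.1)
    (fun s => by simp), ← Finset.univ_product_univ, Finset.expect_product]
  simp

open BigOperators in
/-- Symmetrization: the mean uniform deviation of averages of independent uniform samples from
their means, for a class with at most `M` patterns of differences on `m` pairs of points. -/
lemma expect_iSup_abs_expect_sub_le {P ι : Type*} [Fintype P] [Nonempty P] [Finite ι]
    [Nonempty ι] {m : ℕ} (hm : 0 < m) (g : ι → P → ℝ) (hg : ∀ h x, g h x ∈ Set.Icc 0 1) (M : ℝ)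
    (hM : ∀ p : Fin m → P × P,
      ((Set.range fun h i => g h (p i).1 - g h (p i).2).ncard : ℝ) ≤ M) :
    𝔼 s : Fin m → P, (⨆ h, |𝔼 x, g h x - (∑ i, g h (s i)) / m|) ≤
      Real.sqrt (2 * m * Real.log (2 * M)) / m := by
  have hm0 : (0 : ℝ) < m := by exact_mod_cast hm
  let F : (Fin m → P × P) → ℝ := fun p => ⨆ h, |∑ i, (g h (p i).1 - g h (p i).2)|
  have hghost : ∀ s : Fin m → P, (⨆ h, |𝔼 x, g h x - (∑ i, g h (s i)) / m|) ≤
      𝔼 s' : Fin m → P, F (fun i => (s' i, s i)) / m := by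
    intro s
    refine ciSup_le fun h => ?_
    have h1 : 𝔼 x, g h x - (∑ i, g h (s i)) / m =
        𝔼 s' : Fin m → P, (∑ i, (g h (s' i) - g h (s i))) / m := by
      rw [← Finset.expect_div, Finset.expect_sum_comm]
      simp_rw [Finset.expect_sub_distrib, expect_pi_apply _ (g h), Fintype.expect_const]
      rw [Finset.sum_sub_distrib, Finset.sum_const, Finset.card_univ, Fintype.card_fin,
        nsmul_eq_mul]
      field_simp
    rw [h1]
    refine (Finset.abs_expect_le _ _).trans (Finset.expect_le_expect fun s' _ => ?_)
    rw [abs_div, abs_of_pos hm0]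
    gcongr
    exact le_ciSup (f := fun h => |∑ i, (g h (s' i) - g h (s i))|)
      (Set.finite_range _).bddAbove h
  have hswap : ∀ ε : Fin m → Bool, 𝔼 p, F p =
      𝔼 p : Fin m → P × P, ⨆ h, |∑ i, (if ε i then 1 else -1) * (g h (p i).1 - g h (p i).2)| := by
    intro ε
    refine (Fintype.expect_equiv (Equiv.piCongrRight fun i =>
      if ε i then Equiv.refl (P × P) else Equiv.prodComm P P) _ _ fun p => ?_).symm
    refine iSup_congr fun h => ?_
    congr 1
    refine Finset.sum_congr rfl fun i _ => ?_
    by_cases hi : ε i <;> simp [hi]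
  calc 𝔼 s : Fin m → P, (⨆ h, |𝔼 x, g h x - (∑ i, g h (s i)) / m|)
      ≤ 𝔼 s : Fin m → P, 𝔼 s' : Fin m → P, F (fun i => (s' i, s i)) / m :=
        Finset.expect_le_expect fun s _ => hghost s
    _ = (𝔼 p, F p) / m := by
        simp_rw [← Finset.expect_div]
        rw [Finset.expect_comm, Fintype.expect_equiv
          (Equiv.arrowProdEquivProdArrow (Fin m) (fun _ => P) (fun _ => P)) F
          (fun q => F fun i => (q.1 i, q.2 i)) (fun p => rfl),
          ← Finset.univ_product_univ, Finset.expect_product]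
    _ = (𝔼 ε : Fin m → Bool, 𝔼 p, F p) / m := by rw [Fintype.expect_const]
    _ = (𝔼 p : Fin m → P × P, 𝔼 ε : Fin m → Bool,
          ⨆ h, |∑ i, (if ε i then 1 else -1) * (g h (p i).1 - g h (p i).2)|) / m := by
        rw [Finset.expect_congr rfl fun ε _ => hswap ε, Finset.expect_comm]
    _ ≤ (𝔼 _p : Fin m → P × P, Real.sqrt (2 * m * Real.log (2 * M))) / m := by
        gcongr with p
        refine expect_iSup_abs_sum_sign_le hm (fun h i => g h (p i).1 - g h (p i).2)
          (fun h i => ?_) M (hM p)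
        have h1 := hg h (p i).1
        have h2 := hg h (p i).2
        exact abs_sub_le_iff.2 ⟨by linarith [h1.2, h2.1], by linarith [h1.1, h2.2]⟩
    _ = Real.sqrt (2 * m * Real.log (2 * M)) / m := by rw [Fintype.expect_const]

/-- Any two flags `S ⊆ C` and `S' ⊆ C'` with matching cardinalities are related by a permutation. -/
lemma exists_perm_map_eq_of_card_eq {α : Type*} [Fintype α] [DecidableEq α] {S C S' C' : Finset α}
    (hSC : S ⊆ C) (hSC' : S' ⊆ C') (hS : S.card = S'.card) (hC : C.card = C'.card) :
    ∃ π : Equiv.Perm α, S.map π.toEmbedding = S' ∧ C.map π.toEmbedding = C' := by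
  have hcard : ∀ c : Bool × Bool, Fintype.card {x // (decide (x ∈ S), decide (x ∈ C)) = c} =
      Fintype.card {x // (decide (x ∈ S'), decide (x ∈ C')) = c} := by
    intro c
    rw [Fintype.card_subtype, Fintype.card_subtype]
    have hpart : ∀ {A B : Finset α}, A ⊆ B →
        (Finset.univ.filter fun x => (decide (x ∈ A), decide (x ∈ B)) = c).card =
          if c.1 then (if c.2 then A.card else 0)
          else if c.2 then B.card - A.card else Fintype.card α - B.card := by
      intro A B hAB
      rcases c with ⟨_ | _, _ | _⟩
      · rw [show (Finset.univ.filter fun x => (decide (x ∈ A), decide (x ∈ B)) = (false, false)) =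
          Bᶜ by ext x; have := @hAB x; simp; tauto]
        simp [Finset.card_compl]
      · rw [show (Finset.univ.filter fun x => (decide (x ∈ A), decide (x ∈ B)) = (false, true)) =
          B \ A by ext x; have := @hAB x; simp; tauto]
        simp [Finset.card_sdiff_of_subset hAB]
      · rw [show (Finset.univ.filter fun x => (decide (x ∈ A), decide (x ∈ B)) = (true, false)) =
          ∅ by ext x; have := @hAB x; simp; tauto]
        simp
      · rw [show (Finset.univ.filter fun x => (decide (x ∈ A), decide (x ∈ B)) = (true, true)) =
          A by ext x; have := @hAB x; simp; tauto]
        simp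
    rw [hpart hSC, hpart hSC', hS, hC]
  let e := fun c => Fintype.equivOfCardEq (hcard c)
  have he : ∀ x, (decide (Equiv.ofFiberEquiv e x ∈ S'), decide (Equiv.ofFiberEquiv e x ∈ C')) =
      (decide (x ∈ S), decide (x ∈ C)) := fun x =>
    Equiv.ofFiberEquiv_map (g := fun y => (decide (y ∈ S'), decide (y ∈ C'))) e x
  simp only [Prod.mk.injEq, decide_eq_decide] at he
  refine ⟨Equiv.ofFiberEquiv e, ?_, ?_⟩
  · refine Finset.eq_of_subset_of_card_le (fun y hy => ?_) (by simp [hS])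
    obtain ⟨x, hx, rfl⟩ := Finset.mem_map.1 hy
    exact (he x).1.2 hx
  · refine Finset.eq_of_subset_of_card_le (fun y hy => ?_) (by simp [hC])
    obtain ⟨x, hx, rfl⟩ := Finset.mem_map.1 hy
    exact (he x).2.2 hx

/-- The action of a permutation of `α` on tuples of size-`k` subsets. -/
def tuplePerm {α : Type*} (m k : ℕ) (π : Equiv.Perm α) :
    (Fin m → {S : Finset α // S.card = k}) ≃ (Fin m → {S : Finset α // S.card = k}) :=
  Equiv.piCongrRight fun _ => (Equiv.finsetCongr π).subtypeEquiv (by simp)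

@[simp]
lemma coe_tuplePerm_apply {α : Type*} {k m : ℕ} (π : Equiv.Perm α)
    (s : Fin m → {S : Finset α // S.card = k}) (i : Fin m) :
    (tuplePerm m k π s i).1 = (s i).1.map π.toEmbedding := rfl

section Coupling

variable {α : Type*} [Fintype α] [DecidableEq α] {k m : ℕ}

/-- The size-`n` subsets of `α` containing every set of the tuple `s`. -/
def supersetsOfCard (n : ℕ) (s : Fin m → {S : Finset α // S.card = k}) : Finset (Finset α) :=
  ((Finset.univ : Finset α).powersetCard n).filter fun C => ∀ i, (s i).1 ⊆ C

@[simp]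
lemma mem_supersetsOfCard {n : ℕ} {s : Fin m → {S : Finset α // S.card = k}} {C : Finset α} :
    C ∈ supersetsOfCard n s ↔ C.card = n ∧ ∀ i, (s i).1 ⊆ C := by
  simp [supersetsOfCard]

/-- The conditional probability of `C` given `s`, when `C` is a uniformly random size-`n` superset
of all the sets in `s`. -/
noncomputable def supersetWeight (n : ℕ) (s : Fin m → {S : Finset α // S.card = k})
    (C : Finset α) : ℝ :=
  if ∀ i, (s i).1 ⊆ C then ((supersetsOfCard n s).card : ℝ)⁻¹ else 0

lemma supersetWeight_nonneg (n : ℕ) (s : Fin m → {S : Finset α // S.card = k}) (C : Finset α) :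
    0 ≤ supersetWeight n s C := by
  unfold supersetWeight
  split_ifs <;> positivity

lemma sum_supersetWeight {n : ℕ} (hmk : m * k ≤ n) (hn : n ≤ Fintype.card α)
    (s : Fin m → {S : Finset α // S.card = k}) :
    ∑ C ∈ (Finset.univ : Finset α).powersetCard n, supersetWeight n s C = 1 := by
  have hU : (Finset.univ.biUnion fun i => (s i).1).card ≤ n := by
    refine Finset.card_biUnion_le.trans ?_
    simpa [(s _).2] using hmk
  obtain ⟨C, hC, -, hCn⟩ := Finset.exists_subsuperset_card_eq (Finset.subset_univ _) hU
    (by simpa using hn)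
  have hpos : (supersetsOfCard n s).Nonempty := by
    refine ⟨C, mem_supersetsOfCard.2 ⟨hCn, fun i => ?_⟩⟩
    exact (Finset.subset_biUnion_of_mem (fun i => (s i).1) (Finset.mem_univ i)).trans hC
  have hne : ((supersetsOfCard n s).card : ℝ) ≠ 0 := by
    exact_mod_cast (Finset.card_pos.2 hpos).ne'
  simp only [supersetWeight]
  rw [← Finset.sum_filter, Finset.sum_const, nsmul_eq_mul]
  exact mul_inv_cancel₀ hne

lemma supersetWeight_tuplePerm (n : ℕ) (π : Equiv.Perm α)
    (s : Fin m → {S : Finset α // S.card = k}) (C : Finset α) :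
    supersetWeight n (tuplePerm m k π s) (C.map π.toEmbedding) = supersetWeight n s C := by
  have hcard : (supersetsOfCard n (tuplePerm m k π s)).card = (supersetsOfCard n s).card :=
    (Finset.card_equiv (Equiv.finsetCongr π) fun C => by simp).symm
  simp [supersetWeight, hcard]

/-- If `s` is a uniformly random tuple of size-`k` subsets and `C` is a random size-`n` superset of
its members, then `C` is uniform and each `s i` is, given `C`, uniform among size-`k` subsets
of `C`. -/
lemma sum_supersetWeight_mul {n : ℕ} (hmk : m * k ≤ n) (hn : n ≤ Fintype.card α) (i : Fin m)
    {C : Finset α} (hC : C.card = n) (φ : Finset α → ℝ) :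
    ∑ s : Fin m → {S : Finset α // S.card = k}, supersetWeight n s C * φ (s i).1 =
      (Fintype.card (Fin m → {S : Finset α // S.card = k}) : ℝ) / (Fintype.card α).choose n *
        Qk k C φ := by
  have hkn : k ≤ n := (Nat.le_mul_of_pos_left k i.pos).trans hmk
  let V : {S : Finset α // S.card = k} → Finset α → ℝ := fun S C =>
    ∑ s : Fin m → {S : Finset α // S.card = k}, if s i = S then supersetWeight n s C else 0
  have hV0 : ∀ S D, ¬ S.1 ⊆ D → V S D = 0 := by
    intro S D h
    refine Finset.sum_eq_zero fun s _ => ?_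
    split_ifs with hs
    · exact if_neg fun hall => h (hs ▸ hall i)
    · rfl
  have hVinv : ∀ S D S' D', S.1 ⊆ D → S'.1 ⊆ D' → D.card = D'.card → V S D = V S' D' := by
    intro S D S' D' hS hS' hD
    obtain ⟨π, hπS, hπD⟩ := exists_perm_map_eq_of_card_eq hS hS' (S.2.trans S'.2.symm) hD
    refine Fintype.sum_equiv (tuplePerm m k π) _ _ fun s => ?_
    have hiff : tuplePerm m k π s i = S' ↔ s i = S := by
      rw [Subtype.ext_iff, Subtype.ext_iff, coe_tuplePerm_apply, ← hπS,
        Finset.map_inj]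
    rw [← hπD, supersetWeight_tuplePerm]
    simp only [hiff]
  have hsum : ∀ (D : Finset α) (ψ : Finset α → ℝ),
      ∑ s : Fin m → {S : Finset α // S.card = k}, supersetWeight n s D * ψ (s i).1 =
        ∑ S, V S D * ψ S.1 := by
    intro D ψ
    simp only [V, Finset.sum_mul]
    rw [Finset.sum_comm]
    refine Finset.sum_congr rfl fun s _ => ?_
    simp
  obtain ⟨S₀, hS₀C, hS₀⟩ := Finset.exists_subset_card_eq (hC ▸ hkn)
  set v := V ⟨S₀, hS₀⟩ C
  have hflag : ∀ (D : Finset α) (ψ : Finset α → ℝ), D.card = n →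
      ∑ S, V S D * ψ S.1 = v * ∑ S ∈ D.powersetCard k, ψ S := by
    intro D ψ hD
    have h1 : ∀ S : {S : Finset α // S.card = k},
        V S D * ψ S.1 = if S.1 ⊆ D then v * ψ S.1 else 0 := by
      intro S
      split_ifs with h
      · rw [hVinv S D ⟨S₀, hS₀⟩ C h hS₀C (hD.trans hC.symm)]
      · rw [hV0 S D h, zero_mul]
    simp_rw [h1]
    rw [← Finset.sum_subtype ((Finset.univ : Finset α).powersetCard k) (by simp)
      (fun S => if S ⊆ D then v * ψ S else 0), ← Finset.sum_filter, Finset.mul_sum]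
    refine Finset.sum_congr ?_ fun _ _ => rfl
    ext S
    simp [Finset.mem_powersetCard, and_comm]
  have htotal : (Fintype.card (Fin m → {S : Finset α // S.card = k}) : ℝ) =
      (Fintype.card α).choose n * (v * n.choose k) := by
    calc (Fintype.card (Fin m → {S : Finset α // S.card = k}) : ℝ)
        = ∑ s : Fin m → {S : Finset α // S.card = k},
            ∑ D ∈ (Finset.univ : Finset α).powersetCard n, supersetWeight n s D := by
          simp_rw [sum_supersetWeight hmk hn]
          simp
      _ = ∑ D ∈ (Finset.univ : Finset α).powersetCard n, v * n.choose k := by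
          rw [Finset.sum_comm]
          refine Finset.sum_congr rfl fun D hD => ?_
          have hD' : D.card = n := (Finset.mem_powersetCard.1 hD).2
          have h := (hsum D fun _ => 1).trans (hflag D (fun _ => 1) hD')
          simpa [hD'] using h
      _ = (Fintype.card α).choose n * (v * n.choose k) := by simp
  have hc1 : ((Fintype.card α).choose n : ℝ) ≠ 0 := by exact_mod_cast (Nat.choose_pos hn).ne'
  have hc2 : (n.choose k : ℝ) ≠ 0 := by exact_mod_cast (Nat.choose_pos hkn).ne'
  rw [hsum, hflag C φ hC, htotal, Qk, hC]
  field_simp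

open BigOperators in
lemma Qk_univ_eq_expect (φ : Finset α → ℝ) :
    Qk k Finset.univ φ = 𝔼 S : {S : Finset α // S.card = k}, φ S.1 := by
  rw [Fintype.expect_eq_sum_div_card, Qk, ← Finset.sum_subtype
    ((Finset.univ : Finset α).powersetCard k) (by simp) φ, Fintype.card_finset_len,
    Finset.card_univ, div_eq_inv_mul]

open BigOperators in
/-- The mean uniform deviation under sampling without replacement is at most the one for
independent samples of size-`k` subsets. -/
lemma mean_iSup_abs_Qk_sub_le {ι : Type*} [Finite ι] [Nonempty ι] (hm : 0 < m) {n : ℕ}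
    (hmk : m * k ≤ n) (hn : n ≤ Fintype.card α) (f : ι → Finset α → ℝ) :
    ((Fintype.card α).choose n : ℝ)⁻¹ *
        ∑ C ∈ (Finset.univ : Finset α).powersetCard n,
          (⨆ h, |Qk k Finset.univ (f h) - Qk k C (f h)|) ≤
      𝔼 s : Fin m → {S : Finset α // S.card = k},
        ⨆ h, |𝔼 S : {S : Finset α // S.card = k}, f h S.1 - (∑ i, f h (s i).1) / m| := by
  have hm0 : (0 : ℝ) < m := by exact_mod_cast hm
  have hkN : k ≤ Fintype.card α := ((Nat.le_mul_of_pos_left k hm).trans hmk).trans hn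
  have hP : Nonempty {S : Finset α // S.card = k} := by
    obtain ⟨S, -, hS⟩ := Finset.exists_subset_card_eq (s := (Finset.univ : Finset α)) hkN
    exact ⟨⟨S, hS⟩⟩
  set T := Fintype.card (Fin m → {S : Finset α // S.card = k}) with hT
  have hT0 : (0 : ℝ) < T := by exact_mod_cast Fintype.card_pos
  have hc0 : (0 : ℝ) < (Fintype.card α).choose n := by exact_mod_cast Nat.choose_pos hn
  set G : (Fin m → {S : Finset α // S.card = k}) → ℝ := fun s =>
    ⨆ h, |𝔼 S : {S : Finset α // S.card = k}, f h S.1 - (∑ i, f h (s i).1) / m|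
  have hstep : ∀ C ∈ (Finset.univ : Finset α).powersetCard n,
      (T / (Fintype.card α).choose n : ℝ) * (⨆ h, |Qk k Finset.univ (f h) - Qk k C (f h)|) ≤
        ∑ s, supersetWeight n s C * G s := by
    intro C hC
    have hCn : C.card = n := (Finset.mem_powersetCard.1 hC).2
    have hkC : (C.card.choose k : ℝ) ≠ 0 := by
      rw [hCn]
      exact_mod_cast (Nat.choose_pos ((Nat.le_mul_of_pos_left k hm).trans hmk)).ne'
    rw [Real.mul_iSup_of_nonneg (by positivity)]
    refine ciSup_le fun h => ?_
    have hone : ∑ s : Fin m → {S : Finset α // S.card = k}, supersetWeight n s C =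
        T / (Fintype.card α).choose n := by
      have := sum_supersetWeight_mul hmk hn ⟨0, hm⟩ hCn fun _ => 1
      simpa only [mul_one, Qk, Finset.sum_const, Finset.card_powersetCard, nsmul_eq_mul,
        inv_mul_cancel₀ hkC] using this
    have heq : (T / (Fintype.card α).choose n : ℝ) * (Qk k Finset.univ (f h) - Qk k C (f h)) =
        ∑ s : Fin m → {S : Finset α // S.card = k}, supersetWeight n s C *
          (𝔼 S : {S : Finset α // S.card = k}, f h S.1 - (∑ i, f h (s i).1) / m) := by
      simp_rw [mul_sub, Finset.sum_sub_distrib, ← Finset.sum_mul, hone, Finset.sum_div,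
        Finset.mul_sum, ← Qk_univ_eq_expect]
      rw [Finset.sum_comm]
      simp_rw [← mul_div_assoc, ← Finset.sum_div, sum_supersetWeight_mul hmk hn _ hCn]
      simp only [Finset.sum_const, Finset.card_univ, Fintype.card_fin, nsmul_eq_mul, ← hT]
      field_simp
    rw [← abs_of_pos (div_pos hT0 hc0), ← abs_mul, heq]
    refine (Finset.abs_sum_le_sum_abs _ _).trans (Finset.sum_le_sum fun s _ => ?_)
    rw [abs_mul, abs_of_nonneg (supersetWeight_nonneg n s C)]
    exact mul_le_mul_of_nonneg_left (le_ciSup (f := fun h =>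
      |𝔼 S : {S : Finset α // S.card = k}, f h S.1 - (∑ i, f h (s i).1) / m|)
      (Set.finite_range _).bddAbove h) (supersetWeight_nonneg n s C)
  have htotal := Finset.sum_le_sum hstep
  rw [Finset.sum_comm, ← Finset.mul_sum] at htotal
  simp_rw [← Finset.sum_mul, sum_supersetWeight hmk hn, one_mul] at htotal
  rw [Fintype.expect_eq_sum_div_card, ← hT, le_div_iff₀ hT0]
  refine le_trans (le_of_eq ?_) htotal
  field_simp

end Coupling

open Finset in
/-- A family of subsets of `X` shattering no set of more than `d` elements has at most
`∑ i ≤ d, C(|X|, i)` members. -/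
lemma card_le_sum_choose_of_shatters_card_le {β : Type*} [DecidableEq β] (𝒜 : Finset (Finset β))
    (X : Finset β) (hX : ∀ u ∈ 𝒜, u ⊆ X) (d : ℕ) (hd : ∀ T, 𝒜.Shatters T → #T ≤ d) :
    #𝒜 ≤ ∑ i ∈ range (d + 1), (#X).choose i := by
  calc #𝒜 ≤ #𝒜.shatterer := card_le_card_shatterer 𝒜
    _ ≤ #((range (d + 1)).biUnion fun i => X.powersetCard i) := by
        refine card_le_card fun T hT => ?_
        rw [mem_shatterer] at hT
        obtain ⟨u, hu, hTu⟩ := hT.exists_superset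
        exact mem_biUnion.2 ⟨#T, mem_range.2 (Nat.lt_succ_of_le (hd T hT)),
          mem_powersetCard.2 ⟨hTu.trans (hX u hu), rfl⟩⟩
    _ ≤ ∑ i ∈ range (d + 1), (#X).choose i := by
        refine card_biUnion_le.trans (le_of_eq ?_)
        simp

/-- Sauer–Shelah bound on the number of patterns of differences that a class of VC dimension at
most `d` produces on `m` pairs of size-`k` subsets. -/
lemma ncard_range_sub_le {α : Type*} [DecidableEq α] {k m d : ℕ}
    {H : Set (Finset α → ℝ)} (hbool : ∀ f ∈ H, ∀ S : Finset α, f S = 0 ∨ f S = 1)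
    (hVC : ∀ X, Shatters k H X → X.card ≤ d) (hd : 1 ≤ d) (hdm : d ≤ 2 * m)
    (p : Fin m → {S : Finset α // S.card = k} × {S : Finset α // S.card = k}) :
    ((Set.range fun (f : H) (i : Fin m) => f.1 (p i).1.1 - f.1 (p i).2.1).ncard : ℝ) ≤
      (Real.exp 1 * (2 * m : ℕ) / d) ^ d := by
  classical
  let X : Finset (Finset α) :=
    Finset.univ.image (fun i => (p i).1.1) ∪ Finset.univ.image fun i => (p i).2.1
  have hXcard : X.card ≤ 2 * m := by
    have h1 := Finset.card_image_le (s := Finset.univ) (f := fun i => (p i).1.1)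
    have h2 := Finset.card_image_le (s := Finset.univ) (f := fun i => (p i).2.1)
    have h3 : X.card ≤ _ := Finset.card_union_le (Finset.univ.image fun i => (p i).1.1)
      (Finset.univ.image fun i => (p i).2.1)
    rw [Finset.card_univ, Fintype.card_fin] at h1 h2
    omega
  have hXk : ∀ S ∈ X, S.card = k := by
    intro S hS
    rcases Finset.mem_union.1 hS with h | h <;> obtain ⟨i, -, rfl⟩ := Finset.mem_image.1 h
    exacts [(p i).1.2, (p i).2.2]
  let 𝒜 : Finset (Finset (Finset α)) :=
    X.powerset.filter fun u => ∃ f ∈ H, u = X.filter fun S => f S = 1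
  have hA : ∀ T, 𝒜.Shatters T → T.card ≤ d := by
    intro T hT
    have hTX : T ⊆ X := by
      obtain ⟨u, hu, hTu⟩ := hT.exists_superset
      exact hTu.trans (Finset.mem_powerset.1 (Finset.mem_filter.1 hu).1)
    refine hVC T ⟨fun S hS => hXk S (hTX hS), fun Y hY => ?_⟩
    obtain ⟨u, hu, hTu⟩ := hT hY
    obtain ⟨-, f, hf, rfl⟩ := Finset.mem_filter.1 hu
    have hmem : ∀ S ∈ T, (S ∈ Y ↔ f S = 1) := by
      intro S hS
      rw [← hTu, Finset.mem_inter, Finset.mem_filter]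
      exact ⟨fun h => h.2.2, fun h => ⟨hS, hTX hS, h⟩⟩
    refine ⟨f, hf, fun S hS => (hmem S (hY hS)).1 hS, fun S hS => ?_⟩
    obtain ⟨hST, hSY⟩ := Finset.mem_sdiff.1 hS
    exact (hbool f hf S).resolve_right fun h => hSY ((hmem S hST).2 h)
  have hrange : (Set.range fun (f : H) (i : Fin m) => f.1 (p i).1.1 - f.1 (p i).2.1) ⊆
      (fun (u : Finset (Finset α)) (i : Fin m) =>
        (if (p i).1.1 ∈ u then (1 : ℝ) else 0) - if (p i).2.1 ∈ u then 1 else 0) '' 𝒜 := by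
    rintro _ ⟨⟨f, hf⟩, rfl⟩
    refine ⟨X.filter fun S => f S = 1, ?_, ?_⟩
    · exact Finset.mem_coe.2 (Finset.mem_filter.2
        ⟨Finset.mem_powerset.2 (Finset.filter_subset _ _), f, hf, rfl⟩)
    · have hval : ∀ S ∈ X, (if S ∈ X.filter (fun S => f S = 1) then (1 : ℝ) else 0) = f S := by
        intro S hS
        rcases hbool f hf S with h | h <;> simp [h, hS]
      funext i
      simp only
      rw [hval _ (Finset.mem_union_left _ (Finset.mem_image_of_mem _ (Finset.mem_univ i))),
        hval _ (Finset.mem_union_right _ (Finset.mem_image_of_mem _ (Finset.mem_univ i)))]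
  have hcard : (Set.range fun (f : H) (i : Fin m) => f.1 (p i).1.1 - f.1 (p i).2.1).ncard ≤
      ∑ i ∈ Finset.range (d + 1), (2 * m).choose i :=
    calc _ ≤ _ := Set.ncard_le_ncard hrange (𝒜.finite_toSet.image _)
      _ ≤ (𝒜 : Set (Finset (Finset α))).ncard := Set.ncard_image_le 𝒜.finite_toSet
      _ = 𝒜.card := Set.ncard_coe_finset 𝒜
      _ ≤ ∑ i ∈ Finset.range (d + 1), X.card.choose i :=
        card_le_sum_choose_of_shatters_card_le 𝒜 X
          (fun u hu => Finset.mem_powerset.1 (Finset.mem_filter.1 hu).1) d hA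
      _ ≤ _ := Finset.sum_le_sum fun i _ => Nat.choose_le_choose i hXcard
  refine le_trans ?_ (sum_choose_le_exp_mul_div_pow hd hdm)
  exact_mod_cast hcard

lemma finite_of_forall_eq_zero_or_one {β : Type*} [Finite β] {H : Set (β → ℝ)}
    (hbool : ∀ f ∈ H, ∀ x, f x = 0 ∨ f x = 1) : H.Finite :=
  (Set.Finite.pi' fun _ : β => Set.toFinite ({0, 1} : Set ℝ)).subset fun f hf x => by
    simpa using hbool f hf x

/-- The numerical comparison between Massart's bound for `(2em/d)^d` patterns and the stated
rate. -/
lemma sqrt_log_pow_div_le {m d : ℕ} (hd : 1 ≤ d) (hdm : d ≤ m) :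
    Real.sqrt (2 * m * Real.log (2 * (2 * Real.exp 1 * m / d) ^ d)) / m ≤
      2 * Real.sqrt (2 * d * Real.log (2 * Real.exp 1 * m / d) / m) := by
  have hd1 : (1 : ℝ) ≤ d := by exact_mod_cast hd
  have hdm' : (d : ℝ) ≤ m := by exact_mod_cast hdm
  have hd0 : (0 : ℝ) < d := by linarith
  have hm0 : (0 : ℝ) < m := by linarith
  have he := Real.exp_pos 1
  have h2 : 2 ≤ 2 * Real.exp 1 * m / d := by
    rw [le_div_iff₀ hd0]
    nlinarith [Real.add_one_le_exp 1, mul_le_mul_of_nonneg_left hdm' he.le]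
  set L := Real.log (2 * Real.exp 1 * m / d) with hL
  have hL2 : Real.log 2 ≤ L := Real.log_le_log (by norm_num) h2
  have hL0 : 0 < L := (Real.log_pos (by norm_num)).trans_le hL2
  have hlog : Real.log (2 * (2 * Real.exp 1 * m / d) ^ d) = Real.log 2 + d * L := by
    rw [Real.log_mul (by norm_num) (by positivity), Real.log_pow]
  have hsqrt : 2 * Real.sqrt (2 * d * L / m) * m = Real.sqrt (2 * m * (4 * (d * L))) := by
    rw [show 2 * (m : ℝ) * (4 * (d * L)) = (2 * m) ^ 2 * (2 * d * L / m) by field_simp; ring,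
      Real.sqrt_mul (by positivity), Real.sqrt_sq (by positivity)]
    ring
  rw [div_le_iff₀ hm0, hsqrt, hlog]
  have hdL : L ≤ d * L := le_mul_of_one_le_left hL0.le hd1
  gcongr
  linarith

/-- Theorem 1 of the paper: for a nonempty class `H` of `{0,1}`-valued hypotheses with
VC dimension `d` (with `1 ≤ d ≤ m`, where `m = ⌊n/k⌋`), if `C` is a uniformly random size-`n`
subset of `α`, then `E[ sup_{f ∈ H} |Q_k(univ, f) − Q_k(C, f)| ] ≤ 2·√(2d·log(2em/d)/m)`. -/
theorem stmt0 {α : Type*} [Fintype α] [DecidableEq α] (N k n d : ℕ)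
    (hN : Fintype.card α = N) (hk : 1 ≤ k) (hkn : k ≤ n) (hnN : n ≤ N)
    (H : Set (Finset α → ℝ)) (hH : H.Nonempty)
    (hbool : ∀ f ∈ H, ∀ S : Finset α, f S = 0 ∨ f S = 1)
    (hd : 1 ≤ d) (hdm : d ≤ n / k)
    (hVC : VCDimEq k H d) :
    (N.choose n : ℝ)⁻¹ *
        ∑ C ∈ (Finset.univ : Finset α).powersetCard n,
          (⨆ f : H, |Qk k Finset.univ f.1 - Qk k C f.1|) ≤
      2 * Real.sqrt (2 * d * Real.log (2 * Real.exp 1 * (n / k : ℕ) / d) / (n / k : ℕ)) := by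
  subst hN
  have hm : 0 < n / k := lt_of_lt_of_le hd hdm
  have hmk : n / k * k ≤ n := Nat.div_mul_le_self n k
  have hP : Nonempty {S : Finset α // S.card = k} := by
    obtain ⟨S, -, hS⟩ := Finset.exists_subset_card_eq (s := (Finset.univ : Finset α))
      (hkn.trans hnN)
    exact ⟨⟨S, hS⟩⟩
  have : Finite H := finite_of_forall_eq_zero_or_one hbool
  have : Nonempty H := hH.to_subtype
  have hpattern : ∀ p : Fin (n / k) → {S : Finset α // S.card = k} × {S : Finset α // S.card = k},
      ((Set.range fun (f : H) i => f.1 (p i).1.1 - f.1 (p i).2.1).ncard : ℝ) ≤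
        (2 * Real.exp 1 * (n / k : ℕ) / d) ^ d := by
    intro p
    refine (ncard_range_sub_le hbool (fun X hX => hVC.2 ⟨X, hX, rfl⟩) hd (by omega) p).trans
      (le_of_eq ?_)
    push_cast
    ring
  refine (mean_iSup_abs_Qk_sub_le hm hmk hnN fun f : H => f.1).trans ?_
  refine (expect_iSup_abs_expect_sub_le hm
    (fun (f : H) (S : {S : Finset α // S.card = k}) => f.1 S.1) (fun f S => ?_) _ hpattern).trans
    (sqrt_log_pow_div_le hd hdm)
  rcases hbool f.1 f.2 S.1 with h | h <;> simp [h]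
end

section
/- Let α be a finite type with N elements, let k and n be integers with 1 ≤ k ≤ n ≤ N, set t = ⌊n/k⌋, and let q ≥ 1 be an integer. Consider the following process: sample C uniformly from the size-n subsets of α; then, independently for each j = 1, …, q, sample I_{j,1}, …, I_{j,t} uniformly and independently from the size-k subsets of Fin N, sample g_j uniformly from the set of injective functions from ⋃_{i=1}^t I_{j,i} to C, and set S_{j,i} = g_j '' I_{j,i}. Then for every function f : Finset α → ℝ with values in [0,1] and every ε > 0: P[ | Q_k(C, f) − (1/(q·t)) · ∑_{j=1}^q ∑_{i=1}^t f(S_{j,i}) | ≥ ε ] ≤ 2 · exp(−2 q ε²). -/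
open scoped ENNReal

/-- The sampling process of Lemma 1 of the paper (with `q` repetitions), as a `PMF` built with the
`PMF` monad from uniform distributions: sample a size-`n` subset `C` of `α` uniformly; then,
independently for each `j`, sample size-`k` subsets `I_{j,1}, …, I_{j,t}` of `Fin (card α)`
uniformly and independently, sample an injective function `g_j` from `⋃ᵢ I_{j,i}` to `C`
uniformly, and set `S_{j,i} = g_j '' I_{j,i}`. The output is the pair `(C, S)`. -/
noncomputable def sampleProcQ (α : Type*) [Fintype α] [DecidableEq α] (k n t q : ℕ)
    (hkn : k ≤ n) (hn : n ≤ Fintype.card α) (ht : t * k ≤ n) :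
    PMF (Finset α × (Fin q → Fin t → Finset α)) :=
  haveI hC : Nonempty {C : Finset α // C.card = n} := by
    obtain ⟨s, -, hs⟩ := Finset.exists_subset_card_eq
      (show n ≤ (Finset.univ : Finset α).card by simpa using hn)
    exact ⟨⟨s, hs⟩⟩
  haveI hI : Nonempty {I : Finset (Fin (Fintype.card α)) // I.card = k} := by
    obtain ⟨s, -, hs⟩ := Finset.exists_subset_card_eq
      (show k ≤ (Finset.univ : Finset (Fin (Fintype.card α))).card by
        simpa using (hkn.trans hn))
    exact ⟨⟨s, hs⟩⟩
  (PMF.uniformOfFintype {C : Finset α // C.card = n}).bind fun C =>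
    (PMF.uniformOfFintype
        (Fin q → Fin t → {I : Finset (Fin (Fintype.card α)) // I.card = k})).bind fun I =>
      haveI : ∀ j : Fin q,
          Nonempty {g : ↥(Finset.univ.biUnion fun i => (I j i).1) → α //
            Function.Injective g ∧ ∀ x, g x ∈ C.1} := by
        intro j
        have hU : (Finset.univ.biUnion fun i => (I j i).1).card ≤ n := by
          refine le_trans Finset.card_biUnion_le ?_
          calc ∑ i : Fin t, (I j i).1.card = ∑ _i : Fin t, k :=
                Finset.sum_congr rfl fun i _ => (I j i).2
            _ = t * k := by simp [Finset.sum_const, mul_comm]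
            _ ≤ n := ht
        have hcard :
            Fintype.card ↥(Finset.univ.biUnion fun i => (I j i).1) ≤
              Fintype.card ↥C.1 := by
          rw [Fintype.card_coe, Fintype.card_coe]
          exact hU.trans_eq C.2.symm
        obtain ⟨e⟩ := Function.Embedding.nonempty_of_card_le hcard
        exact ⟨⟨fun x => (e x).1, fun a b hab => e.injective (Subtype.ext hab),
          fun x => (e x).2⟩⟩
      (PMF.uniformOfFintype
          ((j : Fin q) → {g : ↥(Finset.univ.biUnion fun i => (I j i).1) → α //
            Function.Injective g ∧ ∀ x, g x ∈ C.1})).map fun g =>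
        (C.1, fun j i =>
          (I j i).1.attach.image fun x =>
            (g j).1 ⟨x.1, Finset.mem_biUnion.mpr ⟨i, Finset.mem_univ i, x.2⟩⟩)

open MeasureTheory ProbabilityTheory

/-- A bound on the mass of an event that holds for every branch of a `PMF.bind` holds for the
whole. -/
theorem PMF.toOuterMeasure_bind_le {β γ : Type*} (p : PMF β) (F : β → PMF γ) (s : Set γ)
    {c : ℝ≥0∞} (h : ∀ b, (F b).toOuterMeasure s ≤ c) : (p.bind F).toOuterMeasure s ≤ c := by
  rw [PMF.toOuterMeasure_bind_apply]
  calc ∑' b, p b * (F b).toOuterMeasure s ≤ ∑' b, p b * c :=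
        ENNReal.tsum_le_tsum fun b => mul_le_mul_right (h b) _
    _ = c := by rw [ENNReal.tsum_mul_right, p.tsum_coe, one_mul]

/-- The uniform distribution on a finite product is the product of the uniform distributions. -/
theorem PMF.toMeasure_uniformOfFintype_pi {ι : Type*} [Fintype ι] [DecidableEq ι]
    (G : ι → Type*) [∀ j, Fintype (G j)] [∀ j, Nonempty (G j)] [∀ j, MeasurableSpace (G j)]
    [∀ j, MeasurableSingletonClass (G j)] :
    (PMF.uniformOfFintype (∀ j, G j)).toMeasure =
      Measure.pi fun j => (PMF.uniformOfFintype (G j)).toMeasure := by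
  refine Measure.ext_of_singleton fun g => ?_
  rw [PMF.toMeasure_apply_singleton _ _ (measurableSet_singleton g), Measure.pi_singleton]
  simp only [PMF.toMeasure_apply_singleton _ _ (measurableSet_singleton _),
    PMF.uniformOfFintype_apply, Fintype.card_pi, Nat.cast_prod]
  rw [ENNReal.prod_inv_distrib]
  exact fun _ _ _ _ _ => Or.inl (by simp)

/-- The one-sided **Hoeffding inequality** for independent centered variables with range in
intervals of length one. -/
theorem measureReal_sum_ge_le_of_pi {q : ℕ} (hq : 1 ≤ q) {G : Fin q → Type*}
    [∀ j, MeasurableSpace (G j)] (μ : ∀ j, Measure (G j)) [∀ j, IsProbabilityMeasure (μ j)]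
    (Y : ∀ j, G j → ℝ) (hYm : ∀ j, Measurable (Y j)) (a : ℝ)
    (hY : ∀ j x, Y j x ∈ Set.Icc a (a + 1)) (hmean : ∀ j, ∫ x, Y j x ∂(μ j) = 0)
    {ε : ℝ} (hε : 0 ≤ ε) :
    (Measure.pi μ).real {g | q * ε ≤ ∑ j, Y j (g j)} ≤ Real.exp (-2 * q * ε ^ 2) := by
  have hsub : ∀ j ∈ (Finset.univ : Finset (Fin q)),
      HasSubgaussianMGF (fun g : ∀ j, G j => Y j (g j)) ((‖(a + 1) - a‖₊ / 2) ^ 2)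
        (Measure.pi μ) := by
    intro j _
    refine HasSubgaussianMGF.of_map (Y := fun g : ∀ j, G j => g j) (X := Y j)
      (measurable_pi_apply j).aemeasurable ?_
    rw [(measurePreserving_eval μ j).map_eq]
    exact hasSubgaussianMGF_of_mem_Icc_of_integral_eq_zero (hYm j).aemeasurable
      (Filter.Eventually.of_forall (hY j)) (hmean j)
  have h := HasSubgaussianMGF.measure_sum_ge_le_of_iIndepFun
    (iIndepFun_pi fun j => (hYm j).aemeasurable) hsub
    (show 0 ≤ (q : ℝ) * ε by positivity)
  refine h.trans_eq ?_
  congr 1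
  have hq' : (q : ℝ) ≠ 0 := by positivity
  simp
  field_simp

/-- The two-sided **Hoeffding inequality** for the average of `q` independent `[0,1]`-valued
functions with common mean `m` of uniformly distributed variables. -/
theorem PMF.uniformOfFintype_pi_hoeffding {q : ℕ} (hq : 1 ≤ q) (G : Fin q → Type*)
    [∀ j, Fintype (G j)] {hG : Nonempty (∀ j, G j)} (Y : ∀ j, G j → ℝ)
    (hY : ∀ j x, Y j x ∈ Set.Icc (0 : ℝ) 1) (m : ℝ)
    (hmean : ∀ j, ∑ x, Y j x = Fintype.card (G j) * m) {ε : ℝ} (hε : 0 ≤ ε) :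
    (PMF.uniformOfFintype (∀ j, G j)).toOuterMeasure
        {g | ε ≤ |m - (1 / (q : ℝ)) * ∑ j, Y j (g j)|} ≤
      ENNReal.ofReal (2 * Real.exp (-2 * q * ε ^ 2)) := by
  have : ∀ j, Nonempty (G j) := fun j => hG.map fun g => g j
  let : ∀ j, MeasurableSpace (G j) := fun _ => ⊤
  have hq' : (0 : ℝ) < q := by positivity
  set μ : ∀ j, Measure (G j) := fun j => (PMF.uniformOfFintype (G j)).toMeasure
  have hint : ∀ j, ∫ x, Y j x ∂(μ j) = m := by
    intro j
    have hc : (Fintype.card (G j) : ℝ) ≠ 0 := by simp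
    rw [PMF.integral_eq_sum]
    simp only [PMF.uniformOfFintype_apply, ENNReal.toReal_inv, ENNReal.toReal_natCast, smul_eq_mul]
    rw [← Finset.mul_sum, hmean]
    field_simp
  have hm : ∀ j, Measurable (Y j) := fun j => measurable_from_top
  have hi : ∀ j, Integrable (Y j) (μ j) := fun j => Integrable.of_finite
  have h1 := measureReal_sum_ge_le_of_pi hq μ (fun j x => Y j x - m)
    (fun j => (hm j).sub_const m) (-m)
    (fun j x => ⟨by linarith [(hY j x).1], by linarith [(hY j x).2]⟩)
    (fun j => by rw [integral_sub (hi j) (integrable_const _), hint]; simp) hε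
  have h2 := measureReal_sum_ge_le_of_pi hq μ (fun j x => m - Y j x)
    (fun j => (hm j).const_sub m) (m - 1)
    (fun j x => ⟨by linarith [(hY j x).2], by linarith [(hY j x).1]⟩)
    (fun j => by rw [integral_sub (integrable_const _) (hi j), hint]; simp) hε
  rw [← PMF.toMeasure_apply_eq_toOuterMeasure, PMF.toMeasure_uniformOfFintype_pi,
    ← ofReal_measureReal]
  refine ENNReal.ofReal_le_ofReal ?_
  refine (measureReal_mono (s₂ := {g : ∀ j, G j | q * ε ≤ ∑ j, (Y j (g j) - m)} ∪
    {g : ∀ j, G j | q * ε ≤ ∑ j, (m - Y j (g j))}) ?_).trans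
    ((measureReal_union_le _ _).trans (by linarith))
  intro g hg
  simp only [Set.mem_ofPred_eq, Set.mem_union, Finset.sum_sub_distrib, Finset.sum_const,
    Finset.card_univ, Fintype.card_fin, nsmul_eq_mul] at hg ⊢
  have key : (q : ℝ) * (m - (1 / (q : ℝ)) * ∑ j, Y j (g j)) = q * m - ∑ j, Y j (g j) := by
    field_simp
  rcases le_abs.1 hg with h | h
  · right
    have := mul_le_mul_of_nonneg_left h hq'.le
    linarith
  · left
    have := mul_le_mul_of_nonneg_left h hq'.le
    linarith

/-- Two subsets of `C` of the same size are related by a permutation that preserves `C`. -/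
theorem Finset.exists_perm_image_eq {α : Type*} [DecidableEq α] {C S S' : Finset α}
    (hS : S ⊆ C) (hS' : S' ⊆ C) (h : S.card = S'.card) :
    ∃ τ : Equiv.Perm α, S.image τ = S' ∧ ∀ x, τ x ∈ C ↔ x ∈ C := by
  let e : {x : C // x.1 ∈ S} ≃ {x : C // x.1 ∈ S'} :=
    (Equiv.subtypeSubtypeEquivSubtype fun {_} hx => hS hx).trans
      ((Finset.equivOfCardEq h).trans
        (Equiv.subtypeSubtypeEquivSubtype fun {_} hx => hS' hx).symm)
  have hmem : ∀ x (hx : x ∈ C), Equiv.Perm.ofSubtype e.extendSubtype x =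
      (e.extendSubtype ⟨x, hx⟩).1 := fun x hx => Equiv.Perm.ofSubtype_apply_of_mem _ hx
  refine ⟨Equiv.Perm.ofSubtype e.extendSubtype, ?_, fun x => ?_⟩
  · refine Finset.eq_of_subset_of_card_le (fun y hy => ?_) ?_
    · obtain ⟨x, hx, rfl⟩ := Finset.mem_image.1 hy
      rw [hmem x (hS hx)]
      exact e.extendSubtype_mem ⟨x, hS hx⟩ hx
    · rw [Finset.card_image_of_injective _ (Equiv.injective _), h]
  · exact Equiv.Perm.ofSubtype_apply_mem_iff_mem _ _

/-- The image of a fixed size-`k` set under a uniformly random injection into `C` is uniformly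
distributed on the size-`k` subsets of `C`. -/
theorem sum_image_injective_eq_card_mul_Qk {α U : Type*} [DecidableEq α] {k : ℕ} {C : Finset α}
    [Fintype {g : U → α // Function.Injective g ∧ ∀ x, g x ∈ C}] (hk : k ≤ C.card)
    (T : Finset U) (hT : T.card = k) (f : Finset α → ℝ) :
    ∑ g : {g : U → α // Function.Injective g ∧ ∀ x, g x ∈ C}, f (T.image g.1) =
      Fintype.card {g : U → α // Function.Injective g ∧ ∀ x, g x ∈ C} * Qk k C f := by
  let G := {g : U → α // Function.Injective g ∧ ∀ x, g x ∈ C}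
  let M : Finset α → ℕ := fun S => (Finset.univ.filter fun g : G => T.image g.1 = S).card
  have hmaps : ∀ g ∈ (Finset.univ : Finset G), T.image g.1 ∈ C.powersetCard k := by
    intro g _
    rw [Finset.mem_powersetCard, Finset.card_image_of_injective _ g.2.1]
    exact ⟨Finset.image_subset_iff.2 fun x _ => g.2.2 x, hT⟩
  have hle : ∀ S ∈ C.powersetCard k, ∀ S' ∈ C.powersetCard k, M S ≤ M S' := by
    intro S hS S' hS'
    rw [Finset.mem_powersetCard] at hS hS'
    obtain ⟨τ, hτ, hτC⟩ := Finset.exists_perm_image_eq hS.1 hS'.1 (hS.2.trans hS'.2.symm)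
    refine Finset.card_le_card_of_injOn
      (fun g => ⟨τ ∘ g.1, τ.injective.comp g.2.1, fun x => (hτC _).2 (g.2.2 x)⟩) ?_ ?_
    · intro g hg
      simp only [Finset.coe_filter, Finset.mem_univ, true_and, Set.mem_ofPred_eq] at hg ⊢
      rw [← Finset.image_image, hg, hτ]
    · intro g _ g' _ hgg'
      exact Subtype.ext (τ.injective.comp_left (congrArg Subtype.val hgg'))
  obtain ⟨S₀, hS₀⟩ : (C.powersetCard k).Nonempty := Finset.powersetCard_nonempty.2 hk
  have hM : ∀ S ∈ C.powersetCard k, M S = M S₀ := fun S hS =>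
    le_antisymm (hle S hS S₀ hS₀) (hle S₀ hS₀ S hS)
  have hcard : Fintype.card G = C.card.choose k * M S₀ := by
    rw [← Finset.card_univ, Finset.card_eq_sum_card_fiberwise hmaps, Finset.sum_congr rfl hM,
      Finset.sum_const, Finset.card_powersetCard, smul_eq_mul]
  have hchoose : (C.card.choose k : ℝ) ≠ 0 := by exact_mod_cast (Nat.choose_pos hk).ne'
  calc ∑ g : G, f (T.image g.1) = ∑ S ∈ C.powersetCard k, (M S : ℝ) * f S := by
        rw [← Finset.sum_fiberwise_of_maps_to' hmaps]
        simp [M]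
    _ = M S₀ * ∑ S ∈ C.powersetCard k, f S := by
        rw [Finset.mul_sum]
        exact Finset.sum_congr rfl fun S hS => by rw [hM S hS]
    _ = Fintype.card G * Qk k C f := by
        rw [hcard, Qk]
        push_cast
        field_simp

/-- Lemma 1(2) of the paper: for `[0,1]`-valued `f`, the average of `f` over the `q · ⌊n/k⌋`
sampled fragments concentrates around `Q_k(C, f)`:
`P[|Q_k(C, f) − (1/(q·t))·∑_{j,i} f(S_{j,i})| ≥ ε] ≤ 2·exp(−2qε²)`. -/
theorem stmt5 {α : Type*} [Fintype α] [DecidableEq α] (N k n q : ℕ)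
    (hN : Fintype.card α = N) (hk : 1 ≤ k) (hkn : k ≤ n) (hn : n ≤ Fintype.card α)
    (hq : 1 ≤ q) (f : Finset α → ℝ) (hf : ∀ S, f S ∈ Set.Icc (0 : ℝ) 1)
    (ε : ℝ) (hε : 0 < ε) :
    (sampleProcQ α k n (n / k) q hkn hn (Nat.div_mul_le_self n k)).toOuterMeasure
        {x | ε ≤ |Qk k x.1 f -
          (1 / ((q * (n / k) : ℕ) : ℝ)) * ∑ j, ∑ i, f (x.2 j i)|} ≤
      ENNReal.ofReal (2 * Real.exp (-2 * q * ε ^ 2)) := by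
  have ht : 0 < n / k := Nat.div_pos hkn hk
  have ht' : (0 : ℝ) < (n / k : ℕ) := by exact_mod_cast ht
  unfold sampleProcQ
  refine PMF.toOuterMeasure_bind_le _ _ _ fun C => PMF.toOuterMeasure_bind_le _ _ _ fun I => ?_
  rw [PMF.toOuterMeasure_map_apply]
  let G : Fin q → Type _ := fun j => {g : ↥(Finset.univ.biUnion fun i => (I j i).1) → α //
    Function.Injective g ∧ ∀ x, g x ∈ C.1}
  let Y : ∀ j, G j → ℝ := fun j g => (1 / ((n / k : ℕ) : ℝ)) *
    ∑ i, f ((I j i).1.attach.image fun x =>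
      g.1 ⟨x.1, Finset.mem_biUnion.mpr ⟨i, Finset.mem_univ i, x.2⟩⟩)
  refine (measure_mono (t := {g : ∀ j, G j | ε ≤ |Qk k C.1 f - (1 / (q : ℝ)) * ∑ j, Y j (g j)|})
    fun g hg => ?_).trans (PMF.uniformOfFintype_pi_hoeffding hq G Y ?_ (Qk k C.1 f) ?_ hε.le)
  · simp only [Set.mem_preimage, Set.mem_ofPred_eq, Y, ← Finset.mul_sum, ← mul_assoc] at hg ⊢
    rwa [Nat.cast_mul, ← one_div_mul_one_div] at hg
  · intro j g
    refine ⟨mul_nonneg (by positivity) (Finset.sum_nonneg fun i _ => (hf _).1), ?_⟩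
    simp only [Y]
    rw [one_div, inv_mul_le_one₀ ht']
    exact (Finset.sum_le_sum fun i _ => (hf _).2).trans_eq (by simp)
  · intro j
    rw [← Finset.mul_sum, Finset.sum_comm]
    have hterm : ∀ i : Fin (n / k), ∑ g : G j, f ((I j i).1.attach.image fun x =>
            g.1 ⟨x.1, Finset.mem_biUnion.mpr ⟨i, Finset.mem_univ i, x.2⟩⟩) =
        Fintype.card (G j) * Qk k C.1 f := by
      intro i
      rw [← sum_image_injective_eq_card_mul_Qk (hkn.trans_eq C.2.symm)
        ((I j i).1.attach.image fun x =>
          (⟨x.1, Finset.mem_biUnion.mpr ⟨i, Finset.mem_univ i, x.2⟩⟩ :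
            ↥(Finset.univ.biUnion fun i => (I j i).1))) ?_ f]
      · simp only [Finset.image_image, Function.comp_def]
        rfl
      · rw [Finset.card_image_of_injective, Finset.card_attach, (I j i).2]
        intro x y hxy
        exact Subtype.ext (by simpa using hxy)
    rw [Finset.sum_congr rfl fun i _ => hterm i]
    rw [Finset.sum_const, Finset.card_univ, Fintype.card_fin, nsmul_eq_mul]
    field_simp
end
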